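/- arXiv:1606.06707 — 3 statements merged into one kernel-verified Lean document; each statement's English description precedes it below -/
import Mathlib

section
/- Fix P ≥ 0, integers 1 ≤ n ≤ T and 0 ≤ m < n, and a suffix schedule δ : {n,...,T} → Δ; let d = δ_n and let δ' be the restriction of δ to {n+1,...,T}. Then δ is (n,m,P)-feasible if and only if either (i) d > m and δ' is (n+1, m+1, P)-feasible, or (ii) d ≤ m and Σ_{k=n−m}^{n} D(k) ≤ P and δ' is (n+1, d, P)-feasible. -/
namespace IDS

/-- `(n,m,P)`-feasibility of a suffix schedule `δ` on `{n,…,T}`: for every attack start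
`ka ∈ {n−m,…,T}` for which some `k ∈ {max ka n,…,T}` satisfies `δ k ≤ k − ka`, the least
such `k` (denoted `σ`) satisfies `∑_{k=ka}^{σ} D k ≤ P`. -/
def FeasibleSuffix (T : ℕ) (D : ℕ → ℝ) (P : ℝ) (n m : ℕ) (δ : ℕ → ℕ) : Prop :=
  ∀ ka ∈ Finset.Icc (n - m) T,
    (∃ k ∈ Finset.Icc (max ka n) T, δ k ≤ k - ka) →
      (∑ k ∈ Finset.Icc ka (sInf {k | max ka n ≤ k ∧ k ≤ T ∧ δ k ≤ k - ka}), D k) ≤ P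

end IDS

namespace IDS

/-- The timesteps of `{n,…,T}` at which an attack started at `ka` is detected. -/
def detectionTimes (T n ka : ℕ) (δ : ℕ → ℕ) : Set ℕ :=
  {k | max ka n ≤ k ∧ k ≤ T ∧ δ k ≤ k - ka}

theorem feasibleSuffix_iff {T : ℕ} {D : ℕ → ℝ} {P : ℝ} {n m : ℕ} {δ : ℕ → ℕ} :
    FeasibleSuffix T D P n m δ ↔ ∀ ka, n - m ≤ ka → ka ≤ T →
      (detectionTimes T n ka δ).Nonempty →
        ∑ k ∈ Finset.Icc ka (sInf (detectionTimes T n ka δ)), D k ≤ P := by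
  simp only [FeasibleSuffix, detectionTimes, Set.Nonempty, Finset.mem_Icc, Set.mem_ofPred_eq,
    and_imp, and_assoc]

theorem detectionTimes_succ {T n ka : ℕ} {δ : ℕ → ℕ} (h : ka ≤ n → n - ka < δ n) :
    detectionTimes T (n + 1) ka δ = detectionTimes T n ka δ := by
  ext k
  simp only [detectionTimes, Set.mem_ofPred_eq]
  rcases eq_or_ne k n with rfl | hk <;> omega

theorem sInf_detectionTimes_eq {T n ka : ℕ} {δ : ℕ → ℕ} (hnT : n ≤ T) (hka : ka ≤ n)
    (h : δ n ≤ n - ka) : sInf (detectionTimes T n ka δ) = n := by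
  have hleast : IsLeast (detectionTimes T n ka δ) n :=
    ⟨⟨max_le hka le_rfl, hnT, h⟩, fun _ hk => (le_max_right _ _).trans hk.1⟩
  exact hleast.csInf_eq

end IDS

/-- Fix `P ≥ 0`, `1 ≤ n ≤ T`, `0 ≤ m < n`, and a suffix schedule
`δ : {n,…,T} → Δ`; let `d = δ n` (the restriction of `δ` to `{n+1,…,T}` is `δ` itself,
since feasibility at `(n+1,·)` only consults `δ` on `{n+1,…,T}`). Then `δ` is
`(n,m,P)`-feasible iff either (i) `d > m` and `δ` is `(n+1, m+1, P)`-feasible, or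
(ii) `d ≤ m` and `∑_{k=n−m}^{n} D k ≤ P` and `δ` is `(n+1, d, P)`-feasible. -/
theorem feasibleSuffix_recursion
    (T : ℕ) (hT : 1 ≤ T)
    (D : ℕ → ℝ) (hD : ∀ k, 0 ≤ D k) (hD0 : D 0 = 0) (hDT : ∀ k, T < k → D k = 0)
    (Δ : Finset ℕ) (hΔ : Δ.Nonempty)
    (P : ℝ) (hP : 0 ≤ P)
    (n m : ℕ) (hn1 : 1 ≤ n) (hnT : n ≤ T) (hm : m < n)
    (δ : ℕ → ℕ) (hδ : ∀ k ∈ Finset.Icc n T, δ k ∈ Δ) :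
    IDS.FeasibleSuffix T D P n m δ ↔
      ((m < δ n ∧ IDS.FeasibleSuffix T D P (n + 1) (m + 1) δ) ∨
       (δ n ≤ m ∧ (∑ k ∈ Finset.Icc (n - m) n, D k) ≤ P ∧
         IDS.FeasibleSuffix T D P (n + 1) (δ n) δ)) := by
  rw [IDS.feasibleSuffix_iff, IDS.feasibleSuffix_iff, IDS.feasibleSuffix_iff]
  rcases lt_or_ge m (δ n) with h | h
  · simp only [h, h.not_ge, true_and, false_and, or_false, Nat.add_sub_add_right]
    refine forall₂_congr fun ka hka => ?_
    rw [IDS.detectionTimes_succ (by omega)]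
  · simp only [h, h.not_gt, true_and, false_and, false_or]
    constructor
    · refine fun H => ⟨?_, fun ka hka => ?_⟩
      · have hdet : δ n ≤ n - (n - m) := by omega
        have hsum := H (n - m) le_rfl (by omega)
          ⟨n, max_le (Nat.sub_le _ _) le_rfl, hnT, hdet⟩
        rwa [IDS.sInf_detectionTimes_eq hnT (Nat.sub_le _ _) hdet] at hsum
      · rw [IDS.detectionTimes_succ (by omega)]
        exact H ka (by omega)
    · rintro ⟨hsum, H⟩ ka hka
      by_cases hd : ka ≤ n ∧ δ n ≤ n - ka
      · intro _ _
        rw [IDS.sInf_detectionTimes_eq hnT hd.1 hd.2]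
        exact (Finset.sum_le_sum_of_subset_of_nonneg (Finset.Icc_subset_Icc_left hka)
          fun k _ _ => hD k).trans hsum
      · rw [← IDS.detectionTimes_succ (by omega)]
        exact H ka (by omega)
end

section
/- Fix P ≥ 0, integers 1 ≤ n ≤ T and 0 ≤ m < n, and d₀ ∈ Δ. Then the change-cost value function satisfies the Bellman equation V_P(n,m,d₀) = min over d ∈ Δ of [B(d) + (C_d if d ≠ d₀ and n ≥ 2, else 0)], where B(d) = C·FP(d) + V_P(n+1, m+1, d) if d > m; B(d) = C·FP(d) + V_P(n+1, d, d) if d ≤ m and Σ_{k=n−m}^{n} D(k) ≤ P; and B(d) = ⊤ otherwise (all computations in WithTop ℝ, with ⊤ absorbing under addition). -/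
namespace IDS

/-- Number of threshold changes of the suffix schedule `δ` on `{n,…,T}`, that is,
`|{k ∈ {max n 2,…,T} : δ k ≠ δ (k−1)}|` where `δ (n−1)` is interpreted as `d₀`. -/
def suffixChanges (T n d₀ : ℕ) (δ : ℕ → ℕ) : ℕ :=
  ((Finset.Icc (max n 2) T).filter
    (fun k => δ k ≠ (if k = n then d₀ else δ (k - 1)))).card

end IDS

namespace IDS

/-- Feasibility in terms of an explicit first detection time. -/
lemma feasibleSuffix_iff_forall_first_detection {T : ℕ} {D : ℕ → ℝ} {P : ℝ} {n m : ℕ}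
    {δ : ℕ → ℕ} :
    FeasibleSuffix T D P n m δ ↔
      ∀ ka s, n - m ≤ ka → ka ≤ s → n ≤ s → s ≤ T → δ s ≤ s - ka →
        (∀ k, ka ≤ k → n ≤ k → k < s → k - ka < δ k) → ∑ k ∈ Finset.Icc ka s, D k ≤ P := by
  constructor
  · intro h ka s hka hkas hns hsT hs hmin
    have hsInf : sInf {k | max ka n ≤ k ∧ k ≤ T ∧ δ k ≤ k - ka} = s := by
      refine IsLeast.csInf_eq ⟨⟨max_le hkas hns, hsT, hs⟩, ?_⟩
      rintro k ⟨hk, _, hδ⟩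
      by_contra! hlt
      have := hmin k (le_of_max_le_left hk) (le_of_max_le_right hk) hlt
      omega
    have := h ka (Finset.mem_Icc.2 ⟨hka, hkas.trans hsT⟩)
      ⟨s, Finset.mem_Icc.2 ⟨max_le hkas hns, hsT⟩, hs⟩
    rwa [hsInf] at this
  · rintro h ka hka ⟨k, hk, hδ⟩
    rw [Finset.mem_Icc] at hka hk
    have hmem := Nat.sInf_mem (s := {k | max ka n ≤ k ∧ k ≤ T ∧ δ k ≤ k - ka})
      ⟨k, hk.1, hk.2, hδ⟩
    refine h ka _ hka.1 (le_of_max_le_left hmem.1) (le_of_max_le_right hmem.1) hmem.2.1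
      hmem.2.2 ?_
    intro j hj hnj hlt
    by_contra! hle
    exact Nat.notMem_of_lt_sInf hlt ⟨max_le hj hnj, (hlt.le.trans hmem.2.1), hle⟩

lemma feasibleSuffix_congr {T : ℕ} {D : ℕ → ℝ} {P : ℝ} {n m : ℕ} {δ ε : ℕ → ℕ}
    (h : ∀ k, n ≤ k → δ k = ε k) :
    FeasibleSuffix T D P n m δ ↔ FeasibleSuffix T D P n m ε := by
  simp only [feasibleSuffix_iff_forall_first_detection]
  refine forall₅_congr fun ka s _ _ hns => ?_
  rw [h s hns]
  refine forall₂_congr fun _ _ => ?_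
  have : (∀ k, ka ≤ k → n ≤ k → k < s → k - ka < δ k) ↔
      ∀ k, ka ≤ k → n ≤ k → k < s → k - ka < ε k :=
    forall₃_congr fun k _ hk => by rw [h k hk]
  rw [this]

lemma feasibleSuffix_succ_of_lt {T : ℕ} {D : ℕ → ℝ} {P : ℝ} {n m : ℕ} {δ : ℕ → ℕ}
    (hm : m < n) (hd : m < δ n) :
    FeasibleSuffix T D P n m δ ↔ FeasibleSuffix T D P (n + 1) (m + 1) δ := by
  simp only [feasibleSuffix_iff_forall_first_detection]
  constructor
  · intro h ka s hka hkas hns hsT hs hmin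
    refine h ka s (by omega) hkas (by omega) hsT hs fun k hk hnk hks => ?_
    rcases hnk.eq_or_lt with rfl | hlt
    · omega
    · exact hmin k hk hlt hks
  · intro h ka s hka hkas hns hsT hs hmin
    rcases hns.eq_or_lt with rfl | hlt
    · omega
    · exact h ka s (by omega) hkas hlt hsT hs fun k hk hnk hks => hmin k hk (by omega) hks

lemma feasibleSuffix_succ_of_le {T : ℕ} {D : ℕ → ℝ} (hD : ∀ k, 0 ≤ D k) {P : ℝ} {n m : ℕ}
    {δ : ℕ → ℕ} (hm : m < n) (hnT : n ≤ T) (hd : δ n ≤ m) :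
    FeasibleSuffix T D P n m δ ↔
      ∑ k ∈ Finset.Icc (n - m) n, D k ≤ P ∧ FeasibleSuffix T D P (n + 1) (δ n) δ := by
  simp only [feasibleSuffix_iff_forall_first_detection]
  constructor
  · refine fun h => ⟨h (n - m) n le_rfl (by omega) le_rfl hnT (by omega)
      fun k _ _ _ => by omega, ?_⟩
    intro ka s hka hkas hns hsT hs hmin
    refine h ka s (by omega) hkas (by omega) hsT hs fun k hk hnk hks => ?_
    rcases hnk.eq_or_lt with rfl | hlt
    · omega
    · exact hmin k hk hlt hks
  · rintro ⟨hP, h⟩ ka s hka hkas hns hsT hs hmin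
    rcases hns.eq_or_lt with rfl | hlt
    · exact (Finset.sum_le_sum_of_subset_of_nonneg (Finset.Icc_subset_Icc_left hka)
        fun k _ _ => hD k).trans hP
    · refine h ka s ?_ hkas hlt hsT hs fun k hk hnk hks => hmin k hk (by omega) hks
      by_contra! hlt'
      have := hmin n (by omega) le_rfl hlt
      omega

lemma suffixChanges_congr {T n d₀ : ℕ} {δ ε : ℕ → ℕ} (h : ∀ k, n ≤ k → δ k = ε k) :
    suffixChanges T n d₀ δ = suffixChanges T n d₀ ε := by
  unfold suffixChanges
  congr 1
  refine Finset.filter_congr fun k hk => ?_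
  have hnk : n ≤ k := le_of_max_le_left (Finset.mem_Icc.1 hk).1
  rw [h k hnk]
  split_ifs with hkn
  · rfl
  · rw [h (k - 1) (by omega)]

lemma suffixChanges_eq_succ {T n d₀ : ℕ} {δ : ℕ → ℕ} (hn : 1 ≤ n) (hnT : n ≤ T) :
    suffixChanges T n d₀ δ =
      suffixChanges T (n + 1) (δ n) δ + if δ n ≠ d₀ ∧ 2 ≤ n then 1 else 0 := by
  have htail : suffixChanges T (n + 1) (δ n) δ =
      ((Finset.Icc (n + 1) T).filter
        (fun k => δ k ≠ (if k = n then d₀ else δ (k - 1)))).card := by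
    unfold suffixChanges
    rw [max_eq_left (by omega : 2 ≤ n + 1)]
    congr 1
    refine Finset.filter_congr fun k hk => ?_
    have hnk := (Finset.mem_Icc.1 hk).1
    rw [if_neg (by omega : k ≠ n)]
    split_ifs with hkn
    · subst hkn
      simp
    · rfl
  rw [htail]
  unfold suffixChanges
  by_cases h2 : 2 ≤ n
  · rw [max_eq_left h2, ← Finset.insert_Icc_add_one_left_eq_Icc hnT, Finset.filter_insert]
    by_cases hd : δ n = d₀ <;> simp [hd, h2]
  · obtain rfl : n = 1 := by omega
    simp

/-- The cost of the suffix schedule `δ` on `{n,…,T}`. -/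
def suffixCost (T : ℕ) (FP : ℕ → ℝ) (C Cd : ℝ) (n d₀ : ℕ) (δ : ℕ → ℕ) : ℝ :=
  C * ∑ k ∈ Finset.Icc n T, FP (δ k) + Cd * (suffixChanges T n d₀ δ : ℝ)

lemma suffixCost_congr {T : ℕ} {FP : ℕ → ℝ} {C Cd : ℝ} {n d₀ : ℕ} {δ ε : ℕ → ℕ}
    (h : ∀ k, n ≤ k → δ k = ε k) :
    suffixCost T FP C Cd n d₀ δ = suffixCost T FP C Cd n d₀ ε := by
  unfold suffixCost
  rw [suffixChanges_congr h,
    Finset.sum_congr rfl fun k hk => by rw [h k (Finset.mem_Icc.1 hk).1]]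

lemma suffixCost_eq_succ {T : ℕ} {FP : ℕ → ℝ} {C Cd : ℝ} {n d₀ : ℕ} {δ : ℕ → ℕ}
    (hn : 1 ≤ n) (hnT : n ≤ T) :
    suffixCost T FP C Cd n d₀ δ =
      C * FP (δ n) + (if δ n ≠ d₀ ∧ 2 ≤ n then Cd else 0) +
        suffixCost T FP C Cd (n + 1) (δ n) δ := by
  unfold suffixCost
  rw [suffixChanges_eq_succ hn hnT, ← Finset.insert_Icc_add_one_left_eq_Icc hnT,
    Finset.sum_insert (by simp)]
  split_ifs <;> push_cast <;> ring

lemma suffixCost_nonneg {T : ℕ} {FP : ℕ → ℝ} (hFP : ∀ d, 0 ≤ FP d) {C Cd : ℝ} (hC : 0 ≤ C)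
    (hCd : 0 ≤ Cd) (n d₀ : ℕ) (δ : ℕ → ℕ) : 0 ≤ suffixCost T FP C Cd n d₀ δ :=
  add_nonneg (mul_nonneg hC (Finset.sum_nonneg fun _ _ => hFP _))
    (mul_nonneg hCd (Nat.cast_nonneg _))

/-- The costs of the feasible suffix schedules on `{n,…,T}`. -/
def feasibleCosts (T : ℕ) (D : ℕ → ℝ) (Δ : Finset ℕ) (FP : ℕ → ℝ) (C Cd P : ℝ)
    (n m d₀ : ℕ) : Set (WithTop ℝ) :=
  {x | ∃ δ : ℕ → ℕ, (∀ k ∈ Finset.Icc n T, δ k ∈ Δ) ∧ FeasibleSuffix T D P n m δ ∧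
    x = (suffixCost T FP C Cd n d₀ δ : WithTop ℝ)}

lemma isGLB_sInf_feasibleCosts {T : ℕ} {D : ℕ → ℝ} {Δ : Finset ℕ} {FP : ℕ → ℝ}
    (hFP : ∀ d, 0 ≤ FP d) {C Cd : ℝ} (hC : 0 ≤ C) (hCd : 0 ≤ Cd) (P : ℝ) (n m d₀ : ℕ) :
    IsGLB (feasibleCosts T D Δ FP C Cd P n m d₀)
      (sInf (feasibleCosts T D Δ FP C Cd P n m d₀)) := by
  refine WithTop.isGLB_sInf' (β := ℝ) ⟨0, ?_⟩
  rintro x ⟨δ, _, _, rfl⟩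
  exact_mod_cast suffixCost_nonneg hFP hC hCd n d₀ δ

end IDS

/-- If `b` bounds `c + s` from below for all `s ∈ S`, then it bounds `c` plus the infimum of `S`. -/
lemma WithTop.le_coe_add_of_isGLB {S : Set (WithTop ℝ)} {v b : WithTop ℝ} (hv : IsGLB S v)
    (c : ℝ) (h : ∀ s ∈ S, b ≤ (c : WithTop ℝ) + s) : b ≤ (c : WithTop ℝ) + v := by
  have hcancel (s : WithTop ℝ) : (c : WithTop ℝ) + (((-c : ℝ) : WithTop ℝ) + s) = s := by
    rw [← add_assoc, ← WithTop.coe_add]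
    simp
  have hcancel' (s : WithTop ℝ) : ((-c : ℝ) : WithTop ℝ) + ((c : WithTop ℝ) + s) = s := by
    rw [← add_assoc, ← WithTop.coe_add]
    simp
  have hle : ((-c : ℝ) : WithTop ℝ) + b ≤ v := hv.2 fun s hs => by
    have := add_le_add_right (h s hs) ((-c : ℝ) : WithTop ℝ)
    rwa [hcancel'] at this
  have := add_le_add_right hle (c : WithTop ℝ)
  rwa [hcancel] at this

/-- Bellman equation for the change-cost value function
`V_P(n,m,d₀) = inf { C·∑_{k=n}^{T} FP (δ k) + C_d·|{k ∈ {max n 2,…,T} : δ k ≠ δ (k−1)}|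
  : δ an (n,m,P)-feasible suffix schedule }` (with `δ (n−1)` interpreted as `d₀`,
  `⊤` if no feasible suffix schedule exists), computed in `WithTop ℝ`:
`V_P(n,m,d₀) = min_{d ∈ Δ} (B d + (C_d if d ≠ d₀ ∧ n ≥ 2 else 0))`, where
`B d = C·FP d + V_P(n+1,m+1,d)` if `d > m`;
`B d = C·FP d + V_P(n+1,d,d)` if `d ≤ m` and `∑_{k=n−m}^{n} D k ≤ P`;
`B d = ⊤` otherwise. -/
theorem value_function_bellman_with_change_costs
    (T : ℕ) (hT : 1 ≤ T)
    (D : ℕ → ℝ) (hD : ∀ k, 0 ≤ D k) (hD0 : D 0 = 0) (hDT : ∀ k, T < k → D k = 0)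
    (Δ : Finset ℕ) (hΔ : Δ.Nonempty)
    (FP : ℕ → ℝ) (hFP : ∀ d, 0 ≤ FP d)
    (C : ℝ) (hC : 0 < C) (Cd : ℝ) (hCd : 0 ≤ Cd)
    (P : ℝ) (hP : 0 ≤ P)
    (V : ℕ → ℕ → ℕ → WithTop ℝ)
    (hV : ∀ n m d₀ : ℕ, m < n → d₀ ∈ Δ →
      V n m d₀ = sInf {x : WithTop ℝ | ∃ δ : ℕ → ℕ,
        (∀ k ∈ Finset.Icc n T, δ k ∈ Δ) ∧
        IDS.FeasibleSuffix T D P n m δ ∧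
        x = ((C * ∑ k ∈ Finset.Icc n T, FP (δ k)
              + Cd * (IDS.suffixChanges T n d₀ δ : ℝ) : ℝ) : WithTop ℝ)})
    (n m : ℕ) (hn1 : 1 ≤ n) (hnT : n ≤ T) (hm : m < n)
    (d₀ : ℕ) (hd₀ : d₀ ∈ Δ) :
    V n m d₀ = Δ.inf' hΔ (fun d =>
      (if m < d then ((C * FP d : ℝ) : WithTop ℝ) + V (n + 1) (m + 1) d
       else if (∑ k ∈ Finset.Icc (n - m) n, D k) ≤ P then
         ((C * FP d : ℝ) : WithTop ℝ) + V (n + 1) d d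
       else ⊤)
      + (if d ≠ d₀ ∧ 2 ≤ n then ((Cd : ℝ) : WithTop ℝ) else 0)) := by
  have hglb : ∀ n m d₀ : ℕ, m < n → d₀ ∈ Δ →
      IsGLB (IDS.feasibleCosts T D Δ FP C Cd P n m d₀) (V n m d₀) := by
    intro n m d₀ hm hd₀
    rw [hV n m d₀ hm hd₀]
    exact IDS.isGLB_sInf_feasibleCosts hFP hC.le hCd P n m d₀
  have hcoe (d : ℕ) : (if d ≠ d₀ ∧ 2 ≤ n then ((Cd : ℝ) : WithTop ℝ) else 0) =
      ((if d ≠ d₀ ∧ 2 ≤ n then Cd else 0 : ℝ) : WithTop ℝ) := by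
    split_ifs <;> rfl
  have hsplit (δ : ℕ → ℕ) : (IDS.suffixCost T FP C Cd n d₀ δ : WithTop ℝ) =
      ((C * FP (δ n) : ℝ) : WithTop ℝ) + (IDS.suffixCost T FP C Cd (n + 1) (δ n) δ : ℝ) +
        ((if δ n ≠ d₀ ∧ 2 ≤ n then Cd else 0 : ℝ) : WithTop ℝ) := by
    rw [IDS.suffixCost_eq_succ hn1 hnT, ← WithTop.coe_add, ← WithTop.coe_add,
      add_right_comm]
  refine (hglb n m d₀ hm hd₀).unique ⟨?_, ?_⟩
  · rintro x ⟨δ, hδ, hfeas, rfl⟩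
    have hdΔ : δ n ∈ Δ := hδ n (Finset.mem_Icc.2 ⟨le_rfl, hnT⟩)
    have htail : ∀ k ∈ Finset.Icc (n + 1) T, δ k ∈ Δ := fun k hk =>
      hδ k (Finset.Icc_subset_Icc_left n.le_succ hk)
    refine (Finset.inf'_le _ hdΔ).trans ?_
    rw [hcoe, hsplit]
    refine add_le_add_left ?_ _
    split_ifs with hmd hP'
    · exact add_le_add_right ((hglb (n + 1) (m + 1) (δ n) (by omega) hdΔ).1
        ⟨δ, htail, (IDS.feasibleSuffix_succ_of_lt hm hmd).1 hfeas, rfl⟩) _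
    · exact add_le_add_right ((hglb (n + 1) (δ n) (δ n) (by omega) hdΔ).1
        ⟨δ, htail, ((IDS.feasibleSuffix_succ_of_le hD hm hnT (by omega)).1 hfeas).2, rfl⟩) _
    · exact absurd ((IDS.feasibleSuffix_succ_of_le hD hm hnT (by omega)).1 hfeas).1 hP'
  · intro b hb
    refine Finset.le_inf' _ _ fun d hd => ?_
    rw [hcoe]
    have hstep (m' : ℕ) (hm' : m' < n + 1)
        (hext : ∀ δ : ℕ → ℕ, δ n = d → IDS.FeasibleSuffix T D P (n + 1) m' δ →
          IDS.FeasibleSuffix T D P n m δ) :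
        b ≤ ((C * FP d : ℝ) : WithTop ℝ) + V (n + 1) m' d +
          ((if d ≠ d₀ ∧ 2 ≤ n then Cd else 0 : ℝ) : WithTop ℝ) := by
      rw [add_right_comm, ← WithTop.coe_add]
      refine WithTop.le_coe_add_of_isGLB (hglb (n + 1) m' d hm' hd) _ ?_
      rintro s ⟨δ, hδ, hfeas, rfl⟩
      have hagree : ∀ k, n + 1 ≤ k → Function.update δ n d k = δ k := fun k hk =>
        Function.update_of_ne (by omega) _ _
      have hn : Function.update δ n d n = d := Function.update_self _ _ _
      refine (hb ⟨Function.update δ n d, fun k hk => ?_,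
        hext _ hn ((IDS.feasibleSuffix_congr hagree).2 hfeas), rfl⟩).trans_eq ?_
      · rw [Finset.mem_Icc] at hk
        rcases hk.1.eq_or_lt with rfl | hlt
        · rwa [hn]
        · rw [hagree k hlt]
          exact hδ k (Finset.mem_Icc.2 ⟨hlt, hk.2⟩)
      · rw [hsplit, hn, IDS.suffixCost_congr hagree, WithTop.coe_add, add_right_comm]
    generalize (if d ≠ d₀ ∧ 2 ≤ n then Cd else 0 : ℝ) = c at hstep ⊢
    split_ifs with hmd hP'
    · exact hstep (m + 1) (by omega) fun δ hδ h =>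
        (IDS.feasibleSuffix_succ_of_lt hm (by omega)).2 h
    · exact hstep d (by omega) fun δ hδ h =>
        (IDS.feasibleSuffix_succ_of_le hD hm hnT (by omega)).2 ⟨hP', by rwa [hδ]⟩
    · simp
end

section
/- Computing in WithTop ℝ, the coercion of the optimal adaptive-threshold loss min over all schedules δ of Loss(δ) equals min over P ∈ SearchSpace ∪ {0} of (TC(P) + P), where SearchSpace = {Σ_{k=a}^{b} D(k) : 1 ≤ a ≤ b ≤ T} and TC(P) is the infimum of Cost(δ) over schedules δ with maxDamage(δ) ≤ P (⊤ if no such schedule exists). -/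
namespace IDS

/-- The attack starting at `ka` is detected by the schedule `δ` on horizon `{1,…,T}`. -/
def detects (T : ℕ) (δ : ℕ → ℕ) (ka : ℕ) : Prop :=
  ∃ k ∈ Finset.Icc ka T, δ k ≤ k - ka

/-- Detection time: the least `k ∈ {ka,…,T}` with `δ k ≤ k - ka`. -/
noncomputable def detTime (T : ℕ) (δ : ℕ → ℕ) (ka : ℕ) : ℕ :=
  sInf {k | ka ≤ k ∧ k ≤ T ∧ δ k ≤ k - ka}

/-- Attacker's payoff: total damage up to the detection time. -/
noncomputable def payoff (T : ℕ) (D : ℕ → ℝ) (δ : ℕ → ℕ) (ka : ℕ) : ℝ :=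
  ∑ k ∈ Finset.Icc ka (detTime T δ ka), D k

open Classical in
/-- Worst-case damage: maximum payoff over detected attack starts, `0` if none. -/
noncomputable def maxDamage (T : ℕ) (D : ℕ → ℝ) (δ : ℕ → ℕ) : ℝ :=
  if h : ((Finset.Icc 1 T).filter (fun ka => detects T δ ka)).Nonempty then
    ((Finset.Icc 1 T).filter (fun ka => detects T δ ka)).sup' h (payoff T D δ)
  else 0

/-- Number of threshold changes `N(δ) = |{k ∈ {1,…,T−1} : δ k ≠ δ (k+1)}|`. -/
def numChanges (T : ℕ) (δ : ℕ → ℕ) : ℕ :=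
  ((Finset.Icc 1 (T - 1)).filter (fun k => δ k ≠ δ (k + 1))).card

/-- Defender's cost: `C_d·N(δ) + C·∑_{k=1}^{T} FP (δ k)`. -/
noncomputable def defCost (T : ℕ) (C Cd : ℝ) (FP : ℕ → ℝ) (δ : ℕ → ℕ) : ℝ :=
  Cd * (numChanges T δ : ℝ) + C * ∑ k ∈ Finset.Icc 1 T, FP (δ k)

/-- Defender's loss: `Cost(δ) + maxDamage(δ)`. -/
noncomputable def defLoss (T : ℕ) (D : ℕ → ℝ) (C Cd : ℝ) (FP : ℕ → ℝ) (δ : ℕ → ℕ) : ℝ :=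
  defCost T C Cd FP δ + maxDamage T D δ

end IDS

namespace IDS

theorem detTime_mem {T : ℕ} {δ : ℕ → ℕ} {ka : ℕ} (h : detects T δ ka) :
    ka ≤ detTime T δ ka ∧ detTime T δ ka ≤ T := by
  obtain ⟨k, hk, hδ⟩ := h
  rw [Finset.mem_Icc] at hk
  have hmem : detTime T δ ka ∈ {k | ka ≤ k ∧ k ≤ T ∧ δ k ≤ k - ka} :=
    Nat.sInf_mem ⟨k, hk.1, hk.2, hδ⟩
  exact ⟨hmem.1, hmem.2.1⟩

/-- The worst-case damage is `0` or a damage sum over an interval in `{1,…,T}`. -/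
theorem maxDamage_mem (T : ℕ) (D : ℕ → ℝ) (δ : ℕ → ℕ) :
    maxDamage T D δ ∈ insert (0 : ℝ)
      (((Finset.Icc 1 T ×ˢ Finset.Icc 1 T).filter (fun ab => ab.1 ≤ ab.2)).image
        (fun ab => ∑ k ∈ Finset.Icc ab.1 ab.2, D k)) := by
  classical
  rw [Finset.mem_insert]
  unfold maxDamage
  split_ifs with h
  · right
    obtain ⟨ka, hka, heq⟩ := Finset.exists_mem_eq_sup' h (payoff T D δ)
    rw [Finset.mem_filter, Finset.mem_Icc] at hka
    obtain ⟨⟨h1, h2⟩, hdet⟩ := hka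
    obtain ⟨hle, hleT⟩ := detTime_mem hdet
    rw [heq, Finset.mem_image]
    refine ⟨(ka, detTime T δ ka), ?_, rfl⟩
    simp only [Finset.mem_filter, Finset.mem_product, Finset.mem_Icc]
    omega
  · exact Or.inl rfl

theorem maxDamage_nonneg {T : ℕ} {D : ℕ → ℝ} (hD : ∀ k, 0 ≤ D k) (δ : ℕ → ℕ) :
    0 ≤ maxDamage T D δ := by
  unfold maxDamage
  split_ifs with h
  · obtain ⟨ka, hka⟩ := h
    exact (Finset.sum_nonneg fun k _ => hD k : 0 ≤ payoff T D δ ka).trans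
      (Finset.le_sup' (payoff T D δ) hka)
  · exact le_rfl

theorem defCost_nonneg {T : ℕ} {C Cd : ℝ} (hC : 0 ≤ C) (hCd : 0 ≤ Cd) {FP : ℕ → ℝ}
    (hFP : ∀ d, 0 ≤ FP d) (δ : ℕ → ℕ) : 0 ≤ defCost T C Cd FP δ :=
  add_nonneg (mul_nonneg hCd (Nat.cast_nonneg _))
    (mul_nonneg hC (Finset.sum_nonneg fun _ _ => hFP _))

end IDS

/-- In `WithTop ℝ`, the coercion of the optimal adaptive-threshold loss
`min_δ Loss(δ)` equals `min_{P ∈ SearchSpace ∪ {0}} (TC P + P)`, where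
`SearchSpace = {∑_{k=a}^{b} D k : 1 ≤ a ≤ b ≤ T}` and `TC P` is the infimum of
`Cost(δ)` over schedules `δ` with `maxDamage δ ≤ P` (`⊤` if no such schedule exists). -/
theorem optimal_adaptive_loss_eq_min_over_searchSpace
    (T : ℕ) (hT : 1 ≤ T)
    (D : ℕ → ℝ) (hD : ∀ k, 0 ≤ D k) (hD0 : D 0 = 0) (hDT : ∀ k, T < k → D k = 0)
    (Δ : Finset ℕ) (hΔ : Δ.Nonempty)
    (FP : ℕ → ℝ) (hFP : ∀ d, 0 ≤ FP d)
    (C : ℝ) (hC : 0 < C) (Cd : ℝ) (hCd : 0 ≤ Cd)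
    (SearchSpace : Finset ℝ)
    (hS : SearchSpace =
      ((Finset.Icc 1 T ×ˢ Finset.Icc 1 T).filter (fun ab => ab.1 ≤ ab.2)).image
        (fun ab => ∑ k ∈ Finset.Icc ab.1 ab.2, D k))
    (TC : ℝ → WithTop ℝ)
    (hTC : ∀ P : ℝ,
      TC P = sInf {x : WithTop ℝ | ∃ δ : ℕ → ℕ,
        (∀ k ∈ Finset.Icc 1 T, δ k ∈ Δ) ∧
        IDS.maxDamage T D δ ≤ P ∧
        x = ((IDS.defCost T C Cd FP δ : ℝ) : WithTop ℝ)}) :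
    ((sInf {l : ℝ | ∃ δ : ℕ → ℕ, (∀ k ∈ Finset.Icc 1 T, δ k ∈ Δ) ∧
        l = IDS.defLoss T D C Cd FP δ} : ℝ) : WithTop ℝ)
      = (insert (0 : ℝ) SearchSpace).inf' (Finset.insert_nonempty 0 SearchSpace)
          (fun P => TC P + ((P : ℝ) : WithTop ℝ)) := by
  have hGLB (P : ℝ) : IsGLB {x : WithTop ℝ | ∃ δ : ℕ → ℕ,
      (∀ k ∈ Finset.Icc 1 T, δ k ∈ Δ) ∧ IDS.maxDamage T D δ ≤ P ∧
      x = ((IDS.defCost T C Cd FP δ : ℝ) : WithTop ℝ)} (TC P) := by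
    rw [hTC P]
    refine WithTop.isGLB_sInf' ⟨((0 : ℝ) : WithTop ℝ), ?_⟩
    rintro x ⟨δ, -, -, rfl⟩
    exact WithTop.coe_le_coe.2 (IDS.defCost_nonneg hC.le hCd hFP δ)
  have hbdd : BddBelow {l : ℝ | ∃ δ : ℕ → ℕ, (∀ k ∈ Finset.Icc 1 T, δ k ∈ Δ) ∧
      l = IDS.defLoss T D C Cd FP δ} := by
    refine ⟨0, ?_⟩
    rintro l ⟨δ, -, rfl⟩
    exact add_nonneg (IDS.defCost_nonneg hC.le hCd hFP δ) (IDS.maxDamage_nonneg hD δ)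
  apply le_antisymm
  · refine Finset.le_inf' _ _ fun P _ => ?_
    rw [← sub_add_cancel (sInf _) P, WithTop.coe_add]
    gcongr
    refine (hGLB P).2 ?_
    rintro x ⟨δ, hδ, hP, rfl⟩
    rw [WithTop.coe_le_coe, sub_le_iff_le_add]
    exact (csInf_le hbdd ⟨δ, hδ, rfl⟩).trans (add_le_add_right hP _)
  · have hle (δ : ℕ → ℕ) (hδ : ∀ k ∈ Finset.Icc 1 T, δ k ∈ Δ) :
        (insert (0 : ℝ) SearchSpace).inf' (Finset.insert_nonempty 0 SearchSpace)
          (fun P => TC P + ((P : ℝ) : WithTop ℝ)) ≤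
            ((IDS.defLoss T D C Cd FP δ : ℝ) : WithTop ℝ) := by
      refine (Finset.inf'_le _ (hS ▸ IDS.maxDamage_mem T D δ)).trans ?_
      rw [IDS.defLoss, WithTop.coe_add]
      gcongr
      exact (hGLB _).1 ⟨δ, hδ, le_rfl, rfl⟩
    obtain ⟨d, hd⟩ := hΔ
    obtain ⟨r, hr⟩ := WithTop.ne_top_iff_exists.1
      (ne_top_of_le_ne_top WithTop.coe_ne_top (hle (fun _ => d) fun _ _ => hd))
    rw [← hr, WithTop.coe_le_coe]
    refine le_csInf ⟨_, fun _ => d, fun _ _ => hd, rfl⟩ ?_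
    rintro l ⟨δ, hδ, rfl⟩
    rw [← WithTop.coe_le_coe, hr]
    exact hle δ hδ
end
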